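/- arXiv:0912.4100 — 2 statements merged into one kernel-verified Lean document; each statement's English description precedes it below -/
import Mathlib

section
/- Let n ≥ 3. The cycle C_n is 1-elementary if and only if n = 3k for some positive integer k. -/
open Polynomial

namespace MatchPoly

variable {V : Type*}

/-- The number of `r`-matchings in `G`: sets of `r` edges, no two sharing a vertex. -/
noncomputable def numMatchings (G : SimpleGraph V) (r : ℕ) : ℕ :=
  Nat.card {M : Finset (Sym2 V) // M.card = r ∧ (M : Set (Sym2 V)) ⊆ G.edgeSet ∧
    (M : Set (Sym2 V)).Pairwise fun e f => ∀ v : V, v ∈ e → v ∉ f}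

/-- The matching polynomial `μ(G,x) = ∑ (-1)^r p(G,r) x^(n-2r)`. -/
noncomputable def matchingPoly (G : SimpleGraph V) : Polynomial ℝ :=
  ∑ r ∈ Finset.range (Nat.card V + 1),
    Polynomial.C ((-1 : ℝ) ^ r * (numMatchings G r : ℝ)) *
      (Polynomial.X : Polynomial ℝ) ^ (Nat.card V - 2 * r)

/-- `mult θ G`: the multiplicity of `θ` as a root of `μ(G,x)`. -/
noncomputable def mult (θ : ℝ) (G : SimpleGraph V) : ℕ :=
  (matchingPoly G).rootMultiplicity θ

/-- `G \ X`: the induced subgraph on the complement of the vertex set `X`. -/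
def deleteSet (G : SimpleGraph V) (X : Set V) : SimpleGraph ↥(Xᶜ) :=
  G.induce (Xᶜ)

/-- `G \ v`: delete a single vertex. -/
def deleteVert (G : SimpleGraph V) (v : V) : SimpleGraph ↥({v}ᶜ : Set V) :=
  G.induce ({v}ᶜ : Set V)

/-- `u` is θ-essential: `mult(θ, G\u) = mult(θ,G) - 1`. -/
def IsEssential (θ : ℝ) (G : SimpleGraph V) (u : V) : Prop :=
  mult θ (deleteVert G u) + 1 = mult θ G

/-- `u` is θ-neutral: `mult(θ, G\u) = mult(θ,G)`. -/
def IsNeutral (θ : ℝ) (G : SimpleGraph V) (u : V) : Prop :=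
  mult θ (deleteVert G u) = mult θ G

/-- `u` is θ-positive: `mult(θ, G\u) = mult(θ,G) + 1`. -/
def IsPositive (θ : ℝ) (G : SimpleGraph V) (u : V) : Prop :=
  mult θ (deleteVert G u) = mult θ G + 1

/-- `u` is θ-special: not θ-essential but adjacent to a θ-essential vertex. -/
def IsSpecial (θ : ℝ) (G : SimpleGraph V) (u : V) : Prop :=
  ¬ IsEssential θ G u ∧ ∃ w : V, G.Adj u w ∧ IsEssential θ G w

/-- `A_θ(G)`: the set of θ-special vertices. -/
def specialSet (θ : ℝ) (G : SimpleGraph V) : Set V := {u | IsSpecial θ G u}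

/-- `N_θ(G)`: the set of θ-neutral vertices. -/
def neutralSet (θ : ℝ) (G : SimpleGraph V) : Set V := {u | IsNeutral θ G u}

/-- `P_θ(G)`: the set of θ-positive vertices that are not θ-special. -/
def positiveSet (θ : ℝ) (G : SimpleGraph V) : Set V :=
  {u | IsPositive θ G u ∧ ¬ IsSpecial θ G u}

/-- `G` is θ-super positive: `mult(θ,G) = 0` and `mult(θ,G\v) = 1` for every vertex `v`. -/
def IsSuperPositive (θ : ℝ) (G : SimpleGraph V) : Prop :=
  mult θ G = 0 ∧ ∀ v : V, mult θ (deleteVert G v) = 1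

/-- `G` is θ-elementary: θ-super positive and `P_θ(G\v) = ∅` for every vertex `v`. -/
def IsElementary (θ : ℝ) (G : SimpleGraph V) : Prop :=
  IsSuperPositive θ G ∧ ∀ v : V, positiveSet θ (deleteVert G v) = ∅

/-- `G` is θ-critical: every vertex is θ-essential and `mult(θ,G) = 1`. -/
def IsCritical (θ : ℝ) (G : SimpleGraph V) : Prop :=
  (∀ v : V, IsEssential θ G v) ∧ mult θ G = 1

/-- `c_θ(G)`: the number of θ-critical connected components of `G`. -/
noncomputable def numCritComponents (θ : ℝ) (G : SimpleGraph V) : ℕ :=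
  Nat.card {c : G.ConnectedComponent // IsCritical θ (G.induce c.supp)}

/-- `X` is a θ-barrier set: `mult(θ,G) = c_θ(G\X) - |X|`. -/
def IsBarrier (θ : ℝ) (G : SimpleGraph V) (X : Set V) : Prop :=
  numCritComponents θ (deleteSet G X) = mult θ G + X.ncard

/-- `X` is a θ-extreme set: `mult(θ,G\X) = mult(θ,G) + |X|`. -/
def IsExtreme (θ : ℝ) (G : SimpleGraph V) (X : Set V) : Prop :=
  mult θ (deleteSet G X) = mult θ G + X.ncard

/-- `G` is θ-base: θ-super positive and no θ-barrier set contains two adjacent vertices. -/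
def IsBase (θ : ℝ) (G : SimpleGraph V) : Prop :=
  IsSuperPositive θ G ∧
    ∀ X : Set V, IsBarrier θ G X → ∀ u v : V, u ∈ X → v ∈ X → ¬ G.Adj u v

open scoped Classical in
/-- The matchings of `G` all of whose edges lie inside `S`. -/
noncomputable def matchingsOn (G : SimpleGraph V) (S : Finset V) : Finset (Finset (Sym2 V)) :=
  S.sym2.powerset.filter fun M => (M : Set (Sym2 V)) ⊆ G.edgeSet ∧
    (M : Set (Sym2 V)).Pairwise fun e f => ∀ v : V, v ∈ e → v ∉ f

/-- The matching polynomial of the subgraph of `G` induced on `S`. -/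
noncomputable def matchingPolyOn (G : SimpleGraph V) (S : Finset V) : ℝ[X] :=
  ∑ M ∈ matchingsOn G S, C ((-1 : ℝ) ^ M.card) * X ^ (S.card - 2 * M.card)

lemma mem_matchingsOn {G : SimpleGraph V} {S : Finset V} {M : Finset (Sym2 V)} :
    M ∈ matchingsOn G S ↔ (∀ e ∈ M, ∀ v ∈ e, v ∈ S) ∧ (∀ e ∈ M, e ∈ G.edgeSet) ∧
      ∀ e ∈ M, ∀ f ∈ M, ∀ v ∈ e, v ∈ f → e = f := by
  simp only [matchingsOn, Set.subset_def, Finset.mem_coe, Set.Pairwise]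
  grind

lemma two_mul_card_le {G : SimpleGraph V} {S : Finset V} {M : Finset (Sym2 V)}
    (hM : M ∈ matchingsOn G S) : 2 * M.card ≤ S.card := by
  classical
  rw [mem_matchingsOn] at hM
  obtain ⟨hS, hG, hd⟩ := hM
  have h : (M.biUnion Sym2.toFinset).card = ∑ e ∈ M, 2 := by
    rw [Finset.card_biUnion]
    · exact Finset.sum_congr rfl fun e he =>
        Sym2.card_toFinset_of_not_isDiag e (G.not_isDiag_of_mem_edgeSet (hG e he))
    · intro e he f hf hef
      refine Finset.disjoint_left.2 fun v hv hv' => hef ?_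
      exact hd e he f hf v (Sym2.mem_toFinset.1 hv) (Sym2.mem_toFinset.1 hv')
  rw [Finset.sum_const, smul_eq_mul] at h
  rw [mul_comm, ← h]
  refine Finset.card_le_card fun v hv => ?_
  obtain ⟨e, he, hv⟩ := Finset.mem_biUnion.1 hv
  exact hS e he v (Sym2.mem_toFinset.1 hv)

lemma numMatchings_eq_card [Fintype V] (G : SimpleGraph V) (r : ℕ) :
    numMatchings G r = ((matchingsOn G Finset.univ).filter fun M => M.card = r).card := by
  classical
  rw [numMatchings, ← Nat.card_eq_finsetCard]
  refine Nat.card_congr (Equiv.subtypeEquivRight fun M => ?_)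
  simp [matchingsOn, and_comm]

lemma matchingPoly_eq_matchingPolyOn_univ [Fintype V] (G : SimpleGraph V) :
    matchingPoly G = matchingPolyOn G Finset.univ := by
  have hn : Nat.card V = (Finset.univ : Finset V).card := by simp
  rw [matchingPoly, matchingPolyOn, ← Finset.sum_fiberwise_of_maps_to
    (t := Finset.range (Nat.card V + 1)) (g := Finset.card)]
  · refine Finset.sum_congr rfl fun r _ => ?_
    rw [Finset.sum_congr rfl (g := fun _ => C ((-1 : ℝ) ^ r) * X ^ (Nat.card V - 2 * r)),
      Finset.sum_const, ← numMatchings_eq_card]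
    · simp only [map_mul, map_natCast, nsmul_eq_mul]
      ring
    · intro M hM
      rw [(Finset.mem_filter.1 hM).2, hn]
  · intro M hM
    have := two_mul_card_le hM
    rw [Finset.mem_range]
    omega

lemma matchingsOn_map {W : Type*} {G : SimpleGraph V} {H : SimpleGraph W} (φ : G ↪g H)
    (S : Finset V) : matchingsOn H (S.map φ.toEmbedding) =
      (matchingsOn G S).map (Finset.mapEmbedding φ.toEmbedding.sym2Map).toEmbedding := by
  have key (N : Finset (Sym2 V)) : N.map φ.toEmbedding.sym2Map ∈
      matchingsOn H (S.map φ.toEmbedding) ↔ N ∈ matchingsOn G S := by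
    simp only [mem_matchingsOn, Finset.forall_mem_map, Sym2.forall]
    simp
  ext M
  simp only [Finset.mem_map, RelEmbedding.coe_toEmbedding, Finset.mapEmbedding_apply]
  refine ⟨fun hM => ?_, ?_⟩
  · have : M ⊆ S.sym2.map φ.toEmbedding.sym2Map := by
      rw [← Finset.sym2_map]
      exact fun e he => Finset.mem_sym2_iff.2 ((mem_matchingsOn.1 hM).1 e he)
    obtain ⟨N, -, rfl⟩ := Finset.subset_map_iff.1 this
    exact ⟨N, (key N).1 hM, rfl⟩
  · rintro ⟨N, hN, rfl⟩
    exact (key N).2 hN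

lemma matchingPolyOn_map {W : Type*} {G : SimpleGraph V} {H : SimpleGraph W} (φ : G ↪g H)
    (S : Finset V) : matchingPolyOn H (S.map φ.toEmbedding) = matchingPolyOn G S := by
  simp [matchingPolyOn, matchingsOn_map]

lemma matchingPoly_eq_matchingPolyOn_map {W : Type*} [Fintype V] {G : SimpleGraph V}
    {H : SimpleGraph W} (φ : G ↪g H) :
    matchingPoly G = matchingPolyOn H (Finset.univ.map φ.toEmbedding) := by
  rw [matchingPolyOn_map, matchingPoly_eq_matchingPolyOn_univ]

lemma matchingPolyOn_empty (G : SimpleGraph V) : matchingPolyOn G ∅ = 1 := by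
  have : matchingsOn G ∅ = {∅} := by
    ext M
    rw [Finset.mem_singleton, mem_matchingsOn]
    refine ⟨fun h => ?_, by rintro rfl; simp⟩
    refine Finset.eq_empty_of_forall_notMem fun e he => ?_
    simpa using h.1 e he _ e.out_fst_mem
  simp [matchingPolyOn, this]

lemma sum_matchingsOn_insert {A : Type*} [AddCommMonoid A] [DecidableEq V] (G : SimpleGraph V)
    [DecidableRel G.Adj] (S : Finset V) {v : V} (hv : v ∉ S) (F : Finset (Sym2 V) → A) :
    ∑ M ∈ matchingsOn G (insert v S), F M = ∑ M ∈ matchingsOn G S, F M +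
      ∑ w ∈ S with G.Adj v w, ∑ M ∈ matchingsOn G (S.erase w), F (insert s(v, w) M) := by
  have avoid (M) (hM : M ∈ matchingsOn G S) (w) : s(v, w) ∉ M := fun h =>
    hv ((mem_matchingsOn.1 hM).1 _ h v (Sym2.mem_mk_left v w))
  have erase (w) : matchingsOn G (S.erase w) ⊆ matchingsOn G S := by
    intro M
    simp only [mem_matchingsOn]
    grind
  have hdecomp : matchingsOn G (insert v S) = matchingsOn G S ∪
      {w ∈ S | G.Adj v w}.biUnion fun w =>
        (matchingsOn G (S.erase w)).image (insert s(v, w)) := by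
    ext M
    simp only [Finset.mem_union, Finset.mem_biUnion, Finset.mem_image, Finset.mem_filter]
    constructor
    · intro hM
      obtain ⟨hS, hG, hd⟩ := mem_matchingsOn.1 hM
      by_cases h : ∃ e ∈ M, v ∈ e
      · obtain ⟨e, he, hve⟩ := h
        obtain ⟨w, rfl⟩ := Sym2.mem_iff_exists.1 hve
        have hvw : G.Adj v w := hG _ he
        have hwS : w ∈ S := (Finset.mem_insert.1 (hS _ he w (Sym2.mem_mk_right v w))).resolve_left
          hvw.ne'
        refine Or.inr ⟨w, ⟨hwS, hvw⟩, M.erase s(v, w), ?_, Finset.insert_erase he⟩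
        refine mem_matchingsOn.2 ⟨fun f hf x hx => ?_, fun f hf => hG f (Finset.mem_of_mem_erase hf),
          fun f hf g hg => hd f (Finset.mem_of_mem_erase hf) g (Finset.mem_of_mem_erase hg)⟩
        obtain ⟨hne, hfM⟩ := Finset.mem_erase.1 hf
        have hxw : x ≠ w := by
          rintro rfl
          exact hne (hd f hfM _ he x hx (Sym2.mem_mk_right v x))
        have hxv : x ≠ v := by
          rintro rfl
          exact hne (hd f hfM _ he x hx (Sym2.mem_mk_left x w))
        exact Finset.mem_erase.2 ⟨hxw, (Finset.mem_insert.1 (hS f hfM x hx)).resolve_left hxv⟩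
      · refine Or.inl (mem_matchingsOn.2 ⟨fun f hf x hx => ?_, hG, hd⟩)
        refine (Finset.mem_insert.1 (hS f hf x hx)).resolve_left ?_
        rintro rfl
        exact h ⟨f, hf, hx⟩
    · rintro (hM | ⟨w, ⟨hwS, hvw⟩, N, hN, rfl⟩)
      · obtain ⟨hS, hG, hd⟩ := mem_matchingsOn.1 hM
        exact mem_matchingsOn.2 ⟨fun f hf x hx => Finset.mem_insert_of_mem (hS f hf x hx), hG, hd⟩
      · obtain ⟨hS, hG, hd⟩ := mem_matchingsOn.1 hN
        have hdisj (f) (hf : f ∈ N) (x) (hx : x ∈ f) : x ∉ s(v, w) := by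
          have := hS f hf x hx
          rw [Sym2.mem_iff]
          grind
        refine mem_matchingsOn.2 ⟨fun f hf x hx => ?_, fun f hf => ?_, fun f hf g hg x hx hx' => ?_⟩
        · rcases Finset.mem_insert.1 hf with rfl | hf
          · rcases Sym2.mem_iff.1 hx with rfl | rfl
            · exact Finset.mem_insert_self _ _
            · exact Finset.mem_insert_of_mem hwS
          · exact Finset.mem_insert_of_mem (Finset.mem_of_mem_erase (hS f hf x hx))
        · rcases Finset.mem_insert.1 hf with rfl | hf
          · exact hvw
          · exact hG f hf
        · rcases Finset.mem_insert.1 hf with rfl | hf <;> rcases Finset.mem_insert.1 hg with rfl | hg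
          · rfl
          · exact absurd hx (hdisj g hg x hx')
          · exact absurd hx' (hdisj f hf x hx)
          · exact hd f hf g hg x hx hx'
  rw [hdecomp, Finset.sum_union, Finset.sum_biUnion]
  · congr 1
    refine Finset.sum_congr rfl fun w _ => Finset.sum_image ?_
    intro M hM N hN h
    rw [← Finset.erase_insert (avoid M (erase w hM) w),
      ← Finset.erase_insert (avoid N (erase w hN) w)]
    exact congrArg (fun T => T.erase s(v, w)) h
  · intro w hw w' hw' hne
    refine Finset.disjoint_left.2 fun M hM hM' => hne ?_
    obtain ⟨N, hN, rfl⟩ := Finset.mem_image.1 hM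
    obtain ⟨N', hN', h⟩ := Finset.mem_image.1 hM'
    have : s(v, w) ∈ insert s(v, w') N' := h ▸ Finset.mem_insert_self _ _
    rcases Finset.mem_insert.1 this with h | h
    · exact Sym2.congr_right.1 h
    · exact absurd h (avoid N' (erase w' hN') w)
  · refine Finset.disjoint_left.2 fun M hM hM' => ?_
    simp only [Finset.mem_biUnion, Finset.mem_image] at hM'
    obtain ⟨w, -, N, -, rfl⟩ := hM'
    exact avoid _ hM w (Finset.mem_insert_self _ _)

/-- The vertex recurrence for matching polynomials. -/
theorem matchingPolyOn_insert [DecidableEq V] (G : SimpleGraph V) [DecidableRel G.Adj]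
    (S : Finset V) {v : V} (hv : v ∉ S) :
    matchingPolyOn G (insert v S) = X * matchingPolyOn G S -
      ∑ w ∈ S with G.Adj v w, matchingPolyOn G (S.erase w) := by
  rw [matchingPolyOn, sum_matchingsOn_insert G S hv, sub_eq_add_neg, matchingPolyOn,
    Finset.mul_sum, ← Finset.sum_neg_distrib]
  congr 1
  · refine Finset.sum_congr rfl fun M hM => ?_
    have := two_mul_card_le hM
    rw [Finset.card_insert_of_notMem hv, show S.card + 1 - 2 * M.card = S.card - 2 * M.card + 1 by
      omega]
    ring
  · refine Finset.sum_congr rfl fun w hw => ?_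
    rw [matchingPolyOn, ← Finset.sum_neg_distrib]
    refine Finset.sum_congr rfl fun M hM => ?_
    have hw : w ∈ S := (Finset.mem_filter.1 hw).1
    have hM' : s(v, w) ∉ M := fun h => by
      simpa [hv] using (mem_matchingsOn.1 hM).1 _ h v (Sym2.mem_mk_left v w)
    have := Finset.card_erase_add_one hw
    rw [Finset.card_insert_of_notMem hM', Finset.card_insert_of_notMem hv,
      show S.card + 1 - 2 * (M.card + 1) = (S.erase w).card - 2 * M.card by omega, pow_succ]
    simp

/-- The matching polynomials of paths, as a recursive sequence. -/
noncomputable def pathPoly : ℕ → ℝ[X]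
  | 0 => 1
  | 1 => X
  | m + 2 => X * pathPoly (m + 1) - pathPoly m

lemma pathPoly_eval_one (k : ℕ) :
    (pathPoly (3 * k)).eval 1 = (-1) ^ k ∧ (pathPoly (3 * k + 1)).eval 1 = (-1) ^ k ∧
      (pathPoly (3 * k + 2)).eval 1 = 0 := by
  induction k with
  | zero => simp [pathPoly]
  | succ k ih =>
    rw [show 3 * (k + 1) = 3 * k + 1 + 2 by ring]
    obtain ⟨h₀, h₁, h₂⟩ := ih
    simp only [pathPoly, eval_sub, eval_mul, eval_X, h₀, h₁, pow_succ]
    norm_num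

lemma pathPoly_derivative_eval_one (k : ℕ) :
    (derivative (pathPoly (3 * k))).eval 1 = -(-1) ^ k * k ∧
      (derivative (pathPoly (3 * k + 1))).eval 1 = (-1) ^ k * (k + 1) ∧
      (derivative (pathPoly (3 * k + 2))).eval 1 = 2 * (-1) ^ k * (k + 1) := by
  induction k with
  | zero => simp [pathPoly]; norm_num
  | succ k ih =>
    rw [show 3 * (k + 1) = 3 * k + 1 + 2 by ring]
    obtain ⟨h₀, h₁, h₂⟩ := ih
    obtain ⟨e₀, e₁, e₂⟩ := pathPoly_eval_one k
    simp only [pathPoly, derivative_sub, derivative_mul, derivative_X, eval_add, eval_one, eval_sub,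
      eval_mul, eval_X, h₀, h₁, e₀, e₁, pow_succ] at h₂ e₂ ⊢
    push_cast
    refine ⟨?_, ?_, ?_⟩ <;> linarith

lemma pathPoly_ne_zero (m : ℕ) : pathPoly m ≠ 0 := by
  intro h
  obtain ⟨h₀, h₁, -⟩ := pathPoly_eval_one (m / 3)
  have h₂ := (pathPoly_derivative_eval_one (m / 3)).2.2
  have hk : ((m / 3 : ℕ) : ℝ) + 1 ≠ 0 := by positivity
  rcases (show m = 3 * (m / 3) ∨ m = 3 * (m / 3) + 1 ∨ m = 3 * (m / 3) + 2 by omega)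
    with hm | hm | hm
  · rw [← hm, h] at h₀
    exact pow_ne_zero _ (by norm_num) (h₀.symm.trans eval_zero)
  · rw [← hm, h] at h₁
    exact pow_ne_zero _ (by norm_num) (h₁.symm.trans eval_zero)
  · rw [← hm, h] at h₂
    simp [hk] at h₂

lemma rootMultiplicity_pathPoly (m : ℕ) :
    (pathPoly m).rootMultiplicity 1 = if m % 3 = 2 then 1 else 0 := by
  obtain ⟨h₀, h₁, h₂⟩ := pathPoly_eval_one (m / 3)
  split_ifs with h
  · have hm : 3 * (m / 3) + 2 = m := by omega
    have hd := (pathPoly_derivative_eval_one (m / 3)).2.2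
    rw [hm] at h₂ hd
    have hd' : (derivative (pathPoly m)).eval 1 ≠ 0 := by
      rw [hd]
      positivity
    have hne := pathPoly_ne_zero m
    refine le_antisymm ?_ ((rootMultiplicity_pos hne).2 h₂)
    by_contra! hlt
    exact hd' ((one_lt_rootMultiplicity_iff_isRoot hne).1 hlt).2
  · refine rootMultiplicity_eq_zero fun hr => ?_
    rcases (show m = 3 * (m / 3) ∨ m = 3 * (m / 3) + 1 by omega) with hm | hm <;>
    · rw [hm, IsRoot] at hr
      simp [h₀, h₁] at hr

lemma hasse_nat_adj {a b : ℕ} : (SimpleGraph.hasse ℕ).Adj a b ↔ a + 1 = b ∨ b + 1 = a := by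
  simp [SimpleGraph.hasse_adj, Nat.covBy_iff_add_one_eq]

open SimpleGraph in
lemma matchingPolyOn_union_Ico {T : Finset ℕ} {b : ℕ} (hT : ∀ t ∈ T, t + 1 < b) (m : ℕ) :
    matchingPolyOn (hasse ℕ) (T ∪ Finset.Ico b (b + m)) =
      matchingPolyOn (hasse ℕ) T * pathPoly m := by
  classical
  induction m using pathPoly.induct with
  | case1 => simp [pathPoly]
  | case2 =>
    have hb : b ∉ T := fun h => by have := hT b h; omega
    have : T ∪ Finset.Ico b (b + 1) = insert b T := by
      ext; simp
    rw [this, matchingPolyOn_insert _ _ hb, Finset.filter_eq_empty_iff.2]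
    · simp [pathPoly, mul_comm]
    · intro w hw
      have := hT w hw
      rw [hasse_nat_adj]
      omega
  | case3 m ih₁ ih₀ =>
    have hb : b + (m + 1) ∉ T ∪ Finset.Ico b (b + (m + 1)) := by
      intro h
      rcases Finset.mem_union.1 h with h | h
      · have := hT _ h; omega
      · simp at h
    have hset : T ∪ Finset.Ico b (b + (m + 2)) =
        insert (b + (m + 1)) (T ∪ Finset.Ico b (b + (m + 1))) := by
      ext; simp; grind
    have hfilter : {w ∈ T ∪ Finset.Ico b (b + (m + 1)) | (hasse ℕ).Adj (b + (m + 1)) w} =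
        {b + m} := by
      ext w
      simp only [Finset.mem_filter, Finset.mem_union, Finset.mem_Ico, Finset.mem_singleton,
        hasse_nat_adj]
      grind
    have herase : (T ∪ Finset.Ico b (b + (m + 1))).erase (b + m) =
        T ∪ Finset.Ico b (b + m) := by
      ext w
      simp only [Finset.mem_erase, Finset.mem_union, Finset.mem_Ico]
      grind
    rw [hset, matchingPolyOn_insert _ _ hb, hfilter, Finset.sum_singleton, herase, ih₁, ih₀,
      pathPoly]
    ring

open SimpleGraph in
lemma matchingPolyOn_Ico (b m : ℕ) :
    matchingPolyOn (hasse ℕ) (Finset.Ico b (b + m)) = pathPoly m := by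
  simpa [matchingPolyOn_empty] using matchingPolyOn_union_Ico (T := ∅) (b := b) (by simp) m

open SimpleGraph in
lemma matchingPolyOn_Ico_erase (b i j : ℕ) :
    matchingPolyOn (hasse ℕ) ((Finset.Ico b (b + (i + j + 1))).erase (b + i)) =
      pathPoly i * pathPoly j := by
  rw [← matchingPolyOn_Ico b i, ← matchingPolyOn_union_Ico (b := b + i + 1)]
  · congr 1
    ext
    simp only [Finset.mem_erase, Finset.mem_union, Finset.mem_Ico]
    grind
  · intro t ht
    have := Finset.mem_Ico.1 ht
    omega

/-- Cutting the cycle open at `v` sends the remaining vertices to a path on `1, …, n - 1`. -/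
lemma cycleGraph_adj_iff_of_ne {n : ℕ} (hn : 3 ≤ n) {v a b : Fin n} (ha : a ≠ v) (hb : b ≠ v) :
    (SimpleGraph.cycleGraph n).Adj a b ↔
      (SimpleGraph.hasse ℕ).Adj (a - v).val (b - v).val := by
  have : NeZero n := ⟨by omega⟩
  rw [hasse_nat_adj, SimpleGraph.cycleGraph_adj', ← sub_sub_sub_cancel_right a b v,
    ← sub_sub_sub_cancel_right b a v]
  have ha' : 0 < a - v := Fin.pos_iff_ne_zero.2 (sub_ne_zero.2 ha)
  have hb' : 0 < b - v := Fin.pos_iff_ne_zero.2 (sub_ne_zero.2 hb)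
  generalize a - v = a at *
  generalize b - v = b at *
  have h₁ := @Fin.coe_sub_iff_lt n a b
  have h₂ := @Fin.coe_sub_iff_lt n b a
  have h₃ := @Fin.coe_sub_iff_le n a b
  have h₄ := @Fin.coe_sub_iff_le n b a
  simp only [Fin.lt_def, Fin.le_def, Fin.val_zero] at *
  omega

lemma matchingPoly_deleteVert {W : Type*} [DecidableEq W] [Fintype V] {G : SimpleGraph V}
    {H : SimpleGraph W} (φ : G ↪g H) (u : V) :
    matchingPoly (deleteVert G u) =
      matchingPolyOn H ((Finset.univ.map φ.toEmbedding).erase (φ u)) := by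
  classical
  let ι : deleteVert G u ↪g G := SimpleGraph.Embedding.induce _
  rw [matchingPoly_eq_matchingPolyOn_map (ι.trans φ)]
  congr 1
  ext w
  simp only [Finset.mem_map, Finset.mem_erase, Finset.mem_univ, true_and]
  constructor
  · rintro ⟨a, rfl⟩
    exact ⟨fun h => a.2 (φ.injective h), a.1, rfl⟩
  · rintro ⟨hw, a, rfl⟩
    exact ⟨⟨a, fun h => hw (congrArg φ h)⟩, rfl⟩

/-- The embedding of `C_n \ v` in the one-way infinite path given by distance from `v`. -/
def cutEmbedding {n : ℕ} (hn : 3 ≤ n) (v : Fin n) :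
    deleteVert (SimpleGraph.cycleGraph n) v ↪g SimpleGraph.hasse ℕ where
  toFun w := (w.1 - v).val
  inj' a b h := by
    have : NeZero n := ⟨by omega⟩
    exact Subtype.ext (sub_left_injective (Fin.val_injective h))
  map_rel_iff' {a b} := (cycleGraph_adj_iff_of_ne hn a.2 b.2).symm

lemma map_cutEmbedding {n : ℕ} (hn : 3 ≤ n) (v : Fin n) :
    Finset.univ.map (cutEmbedding hn v).toEmbedding = Finset.Ico 1 n := by
  have : NeZero n := ⟨by omega⟩
  ext i
  simp only [Finset.mem_map, Finset.mem_univ, true_and, Finset.mem_Ico]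
  constructor
  · rintro ⟨a, rfl⟩
    exact ⟨Fin.pos_iff_ne_zero.2 (sub_ne_zero.2 a.2), Fin.isLt _⟩
  · rintro ⟨hi, hin⟩
    have hne : (⟨i, hin⟩ : Fin n) ≠ 0 := by
      intro h
      have := congrArg Fin.val h
      simp at this
      omega
    refine ⟨⟨⟨i, hin⟩ + v, fun h => hne (by simpa using h)⟩, ?_⟩
    change (⟨i, hin⟩ + v - v : Fin n).val = i
    rw [add_sub_cancel_right]

lemma cutEmbedding_mem_Ico {n : ℕ} (hn : 3 ≤ n) (v : Fin n) (u : ↥({v}ᶜ : Set (Fin n))) :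
    cutEmbedding hn v u ∈ Finset.Ico 1 n := by
  rw [← map_cutEmbedding hn v]
  exact Finset.mem_map_of_mem _ (Finset.mem_univ u)

lemma mult_deleteVert_cycleGraph {n : ℕ} (hn : 3 ≤ n) (v : Fin n) :
    mult 1 (deleteVert (SimpleGraph.cycleGraph n) v) = if (n - 1) % 3 = 2 then 1 else 0 := by
  rw [mult, matchingPoly_eq_matchingPolyOn_map (cutEmbedding hn v), map_cutEmbedding,
    ← rootMultiplicity_pathPoly, ← matchingPolyOn_Ico 1, Nat.add_sub_cancel' (by omega)]

lemma matchingPoly_deleteVert_deleteVert_cycleGraph {n : ℕ} (hn : 3 ≤ n) (v : Fin n)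
    (u : ↥({v}ᶜ : Set (Fin n))) :
    matchingPoly (deleteVert (deleteVert (SimpleGraph.cycleGraph n) v) u) =
      pathPoly (cutEmbedding hn v u - 1) * pathPoly (n - 1 - cutEmbedding hn v u) := by
  rw [matchingPoly_deleteVert (cutEmbedding hn v), map_cutEmbedding,
    ← matchingPolyOn_Ico_erase 1]
  have := Finset.mem_Ico.1 (cutEmbedding_mem_Ico hn v u)
  congr 3 <;> omega

lemma mult_deleteVert_deleteVert_cycleGraph {n : ℕ} (hn : 3 ≤ n) (v : Fin n)
    (u : ↥({v}ᶜ : Set (Fin n))) :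
    mult 1 (deleteVert (deleteVert (SimpleGraph.cycleGraph n) v) u) =
      (if (cutEmbedding hn v u - 1) % 3 = 2 then 1 else 0) +
        if (n - 1 - cutEmbedding hn v u) % 3 = 2 then 1 else 0 := by
  rw [mult, matchingPoly_deleteVert_deleteVert_cycleGraph,
    rootMultiplicity_mul (mul_ne_zero (pathPoly_ne_zero _) (pathPoly_ne_zero _)),
    rootMultiplicity_pathPoly, rootMultiplicity_pathPoly]

/-- The vertex recurrence for matching polynomials, in terms of vertex deletions. -/
theorem matchingPoly_eq_sub_sum [Fintype V] [DecidableEq V] (G : SimpleGraph V)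
    [DecidableRel G.Adj] (v : V) :
    matchingPoly G = X * matchingPoly (deleteVert G v) -
      ∑ w ∈ Finset.univ.filter fun w : ↥({v}ᶜ : Set V) => G.Adj v w,
        matchingPoly (deleteVert (deleteVert G v) w) := by
  let ι : deleteVert G v ↪g G := SimpleGraph.Embedding.induce _
  have hι : Finset.univ.map ι.toEmbedding = Finset.univ.erase v := by
    ext w
    simp [ι]
  rw [matchingPoly_eq_matchingPolyOn_univ, ← Finset.insert_erase (Finset.mem_univ v),
    matchingPolyOn_insert _ _ (Finset.notMem_erase _ _), ← hι,
    ← matchingPoly_eq_matchingPolyOn_map, Finset.filter_map, Finset.sum_map]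
  congr 1
  refine Finset.sum_congr rfl fun w _ => ?_
  rw [matchingPoly_deleteVert ι]
  rfl

lemma mult_cycleGraph {n : ℕ} (hn : 3 ≤ n) (h3 : n % 3 = 0) :
    mult 1 (SimpleGraph.cycleGraph n) = 0 := by
  classical
  have : NeZero n := ⟨by omega⟩
  let v : Fin n := 0
  refine rootMultiplicity_eq_zero fun hr => ?_
  have hdel : (matchingPoly (deleteVert (SimpleGraph.cycleGraph n) v)).eval 1 = 0 := by
    have hm : 0 < mult 1 (deleteVert (SimpleGraph.cycleGraph n) v) := by
      rw [mult_deleteVert_cycleGraph hn, if_pos (by omega)]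
      exact one_pos
    exact (rootMultiplicity_pos'.1 hm).2
  have hnbr (w : ↥({v}ᶜ : Set (Fin n))) (hw : (SimpleGraph.cycleGraph n).Adj v w) :
      (matchingPoly (deleteVert (deleteVert (SimpleGraph.cycleGraph n) v) w)).eval 1 =
        (-1) ^ (n / 3 - 1) := by
    have hw' : cutEmbedding hn v w = 1 ∨ cutEmbedding hn v w = n - 1 := by
      rw [SimpleGraph.cycleGraph_adj'] at hw
      have hpos : 0 < w.1 - v := Fin.pos_iff_ne_zero.2 (sub_ne_zero.2 w.2)
      have h := @Fin.coe_sub_iff_lt n 0 (w.1 - v)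
      rw [zero_sub, neg_sub] at h
      have := h.2 hpos
      rw [Fin.val_zero] at this
      change (w.1 - v).val = 1 ∨ (w.1 - v).val = n - 1
      omega
    have he := (pathPoly_eval_one (n / 3 - 1)).2.1
    rw [show 3 * (n / 3 - 1) + 1 = n - 2 by omega] at he
    rw [matchingPoly_deleteVert_deleteVert_cycleGraph hn, eval_mul]
    rcases hw' with h | h <;> rw [h]
    · simpa [pathPoly, Nat.sub_sub] using he
    · simpa [pathPoly, Nat.sub_sub] using he
  rw [IsRoot, matchingPoly_eq_sub_sum _ v, eval_sub, eval_mul, hdel, mul_zero, zero_sub,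
    neg_eq_zero, eval_finsetSum, Finset.sum_congr rfl fun w hw => hnbr w (Finset.mem_filter.1 hw).2,
    Finset.sum_const, nsmul_eq_mul, mul_eq_zero, Nat.cast_eq_zero, Finset.card_eq_zero] at hr
  obtain ⟨w, hw⟩ : ∃ w, (SimpleGraph.cycleGraph n).Adj v w := by
    refine ⟨⟨1, by omega⟩, ?_⟩
    rw [SimpleGraph.cycleGraph_adj']
    simp [v]
  rcases hr with hr | hr
  · exact Finset.filter_eq_empty_iff.1 hr (x := ⟨w, hw.ne'⟩) (Finset.mem_univ _) hw
  · exact pow_ne_zero _ (by norm_num) hr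

/-- The cycle C_n is 1-elementary iff n = 3k for some positive integer k. -/
theorem stmt_12 (n : ℕ) (hn : 3 ≤ n) :
    IsElementary 1 (SimpleGraph.cycleGraph n) ↔ ∃ k : ℕ, 0 < k ∧ n = 3 * k := by
  constructor
  · rintro ⟨⟨-, h⟩, -⟩
    have := h ⟨0, by omega⟩
    rw [mult_deleteVert_cycleGraph hn] at this
    split_ifs at this
    exact ⟨n / 3, by omega, by omega⟩
  · rintro ⟨k, -, hk⟩
    have hone (v : Fin n) : mult 1 (deleteVert (SimpleGraph.cycleGraph n) v) = 1 := by
      rw [mult_deleteVert_cycleGraph hn, if_pos (by omega)]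
    refine ⟨⟨mult_cycleGraph hn (by omega), hone⟩, fun v => ?_⟩
    refine Set.eq_empty_of_forall_notMem fun u ⟨hpos, hspec⟩ => hspec ⟨?_, ?_⟩
    · rw [IsPositive] at hpos
      rw [IsEssential]
      omega
    rw [IsPositive, hone, mult_deleteVert_deleteVert_cycleGraph hn] at hpos
    have hu := Finset.mem_Ico.1 (cutEmbedding_mem_Ico hn v u)
    have hmod : cutEmbedding hn v u % 3 = 0 := by
      split_ifs at hpos <;> omega
    have hw : cutEmbedding hn v u - 1 ∈ Finset.univ.map (cutEmbedding hn v).toEmbedding := by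
      rw [map_cutEmbedding, Finset.mem_Ico]
      omega
    obtain ⟨w, -, hw⟩ := Finset.mem_map.1 hw
    change cutEmbedding hn v w = _ at hw
    refine ⟨w, ?_, ?_⟩
    · rw [← (cutEmbedding hn v).map_adj_iff, hasse_nat_adj]
      omega
    · rw [IsEssential, hone, mult_deleteVert_deleteVert_cycleGraph hn, if_neg (by omega),
        if_neg (by omega)]

end MatchPoly
end

section
/- Let k be a positive integer and let C_{3k} be the cycle on vertices 1, 2, …, 3k (with i adjacent to i+1 and 3k adjacent to 1). Then C_{3k} has exactly three nonempty 1-barrier sets, namely {1,4,7,…,3k−2}, {2,5,8,…,3k−1}, and {3,6,9,…,3k} (the three residue classes modulo 3). -/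
open Polynomial

namespace MatchPoly

variable {V : Type*}

/-- Two edges are vertex-disjoint. -/
def EdgeDisjoint (e f : Sym2 V) : Prop := ∀ v : V, v ∈ e → v ∉ f

theorem EdgeDisjoint.symm {e f : Sym2 V} (h : EdgeDisjoint e f) : EdgeDisjoint f e :=
  fun v hf he => h v he hf

theorem not_edgeDisjoint_self (e : Sym2 V) : ¬ EdgeDisjoint e e :=
  fun h => h _ e.out_fst_mem e.out_fst_mem

open scoped Classical in
/-- The matchings contained in a finite set of edges. -/
noncomputable def matchingsIn (E : Finset (Sym2 V)) : Finset (Finset (Sym2 V)) :=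
  E.powerset.filter fun M => (M : Set (Sym2 V)).Pairwise EdgeDisjoint

theorem mem_matchingsIn {E M : Finset (Sym2 V)} :
    M ∈ matchingsIn E ↔ M ⊆ E ∧ (M : Set (Sym2 V)).Pairwise EdgeDisjoint := by
  classical
  rw [matchingsIn, Finset.mem_filter, Finset.mem_powerset]

/-- The signed count `∑ (-1)^|M|` of the matchings `M` contained in a finite set of edges. -/
noncomputable def signedCount (E : Finset (Sym2 V)) : ℝ :=
  ∑ M ∈ matchingsIn E, (-1 : ℝ) ^ M.card

theorem signedCount_empty : signedCount (∅ : Finset (Sym2 V)) = 1 := by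
  simp [signedCount, matchingsIn, Finset.filter_singleton]

theorem signedCount_insert [DecidableEq V] {E : Finset (Sym2 V)} {e : Sym2 V}
    [DecidablePred (EdgeDisjoint e)] (he : e ∉ E) :
    signedCount (insert e E) = signedCount E - signedCount (E.filter (EdgeDisjoint e)) := by
  classical
  have hE : (E.powerset.filter fun M : Finset (Sym2 V) =>
      ((insert e M : Finset (Sym2 V)) : Set (Sym2 V)).Pairwise EdgeDisjoint) =
      matchingsIn (E.filter (EdgeDisjoint e)) := by
    ext M
    simp only [Finset.mem_filter, Finset.mem_powerset, mem_matchingsIn, Finset.coe_insert,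
      Finset.subset_iff]
    constructor
    · rintro ⟨hM, h⟩
      refine ⟨fun f hf => ⟨hM hf, ?_⟩, h.mono (Set.subset_insert _ _)⟩
      exact h (Set.mem_insert _ _) (Set.mem_insert_of_mem _ hf) fun hef => he (hef ▸ hM hf)
    · rintro ⟨hM, h⟩
      refine ⟨fun f hf => (hM hf).1, h.insert fun f hf _ => ⟨(hM hf).2, (hM hf).2.symm⟩⟩
  rw [signedCount, signedCount, signedCount, ← hE, matchingsIn, matchingsIn, Finset.sum_filter,
    Finset.sum_filter, Finset.sum_filter, Finset.sum_powerset_insert he, sub_eq_add_neg,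
    ← Finset.sum_neg_distrib]
  congr 1
  refine Finset.sum_congr rfl fun M hM => ?_
  rw [Finset.card_insert_of_notMem fun h => he (Finset.mem_powerset.1 hM h), pow_succ,
    mul_neg_one]
  split_ifs <;> simp

theorem signedCount_map {W : Type*} (φ : V ↪ W) (E : Finset (Sym2 V)) :
    signedCount (E.map φ.sym2Map) = signedCount E := by
  classical
  have hdisj : ∀ e f : Sym2 V, EdgeDisjoint (φ.sym2Map e) (φ.sym2Map f) ↔ EdgeDisjoint e f := by
    intro e f
    simp only [EdgeDisjoint, Function.Embedding.sym2Map_apply, Sym2.mem_map]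
    constructor
    · intro h v hv hf
      exact h _ ⟨v, hv, rfl⟩ ⟨v, hf, rfl⟩
    · rintro h _ ⟨v, hv, rfl⟩ ⟨w, hw, hwv⟩
      exact h v hv (φ.injective hwv ▸ hw)
  unfold signedCount
  symm
  refine Finset.sum_bij (fun M _ => M.map φ.sym2Map) ?_ ?_ ?_ ?_
  · intro M hM
    rw [mem_matchingsIn] at hM ⊢
    refine ⟨Finset.map_subset_map.2 hM.1, ?_⟩
    rw [Finset.coe_map, Set.InjOn.pairwise_image φ.sym2Map.injective.injOn]
    exact hM.2.imp fun _ _ h => (hdisj _ _).2 h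
  · intro M _ N _ h
    exact Finset.map_injective _ h
  · intro N hN
    rw [mem_matchingsIn] at hN
    obtain ⟨M, hM, rfl⟩ := Finset.subset_map_iff.1 hN.1
    refine ⟨M, ?_, rfl⟩
    rw [mem_matchingsIn]
    refine ⟨hM, ?_⟩
    have := hN.2
    rw [Finset.coe_map, Set.InjOn.pairwise_image φ.sym2Map.injective.injOn] at this
    exact this.imp fun _ _ h => (hdisj _ _).1 h
  · intro M _
    simp

theorem card_le_of_pairwise_edgeDisjoint [Finite V] {M : Finset (Sym2 V)}
    (hM : (M : Set (Sym2 V)).Pairwise EdgeDisjoint) : M.card ≤ Nat.card V := by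
  have := Fintype.ofFinite V
  rw [Nat.card_eq_fintype_card, ← Finset.card_univ]
  refine Finset.card_le_card_of_injOn (fun e => e.out.1) (by simp) ?_
  intro e he f hf hef
  by_contra hne
  refine hM he hf hne _ e.out_fst_mem ?_
  dsimp only at hef
  rw [hef]
  exact f.out_fst_mem

theorem eval_one_matchingPoly [Finite V] (G : SimpleGraph V) {E : Finset (Sym2 V)}
    (hE : (E : Set (Sym2 V)) = G.edgeSet) : (matchingPoly G).eval 1 = signedCount E := by
  classical
  have hnum : ∀ r, numMatchings G r = ((matchingsIn E).filter fun M => M.card = r).card := by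
    intro r
    rw [numMatchings, ← Nat.card_eq_finsetCard]
    refine Nat.card_congr (Equiv.subtypeEquivRight fun M => ?_)
    rw [Finset.mem_filter, mem_matchingsIn, ← hE, Finset.coe_subset]
    exact and_comm
  unfold matchingPoly signedCount
  rw [eval_finsetSum, ← Finset.sum_fiberwise_of_maps_to (g := Finset.card)
    (t := Finset.range (Nat.card V + 1))]
  · refine Finset.sum_congr rfl fun r _ => ?_
    rw [Finset.sum_congr rfl (g := fun _ => (-1 : ℝ) ^ r)
      fun M hM => by rw [(Finset.mem_filter.1 hM).2], hnum]
    simp [mul_comm]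
  · intro M hM
    exact Finset.mem_range.2
      (Nat.lt_succ_of_le (card_le_of_pairwise_edgeDisjoint (mem_matchingsIn.1 hM).2))

theorem numMatchings_zero (G : SimpleGraph V) : numMatchings G 0 = 1 := by
  rw [numMatchings, Nat.card_eq_one_iff_unique]
  refine ⟨⟨fun a b => ?_⟩, ⟨⟨∅, by simp⟩⟩⟩
  ext1
  rw [Finset.card_eq_zero.1 a.2.1, Finset.card_eq_zero.1 b.2.1]

theorem matchingPoly_ne_zero (G : SimpleGraph V) : matchingPoly G ≠ 0 := by
  intro h
  have h1 := congrArg (fun p => p.coeff (Nat.card V)) h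
  simp only [matchingPoly, finsetSum_coeff, coeff_C_mul, coeff_X_pow, coeff_zero] at h1
  rw [Finset.sum_eq_single 0] at h1
  · simp [numMatchings_zero] at h1
  · intro r hr h0
    rw [Finset.mem_range] at hr
    rw [if_neg (by omega), mul_zero]
  · simp

theorem mult_eq_zero_iff {G : SimpleGraph V} {θ : ℝ} :
    mult θ G = 0 ↔ (matchingPoly G).eval θ ≠ 0 := by
  rw [mult, rootMultiplicity_eq_zero_iff]
  simp [matchingPoly_ne_zero, IsRoot]

theorem mult_one_eq_zero_of_subsingleton [Subsingleton V] (G : SimpleGraph V) :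
    mult 1 G = 0 := by
  rw [mult_eq_zero_iff, eval_one_matchingPoly G (E := ∅), signedCount_empty]
  · exact one_ne_zero
  · rw [Finset.coe_empty, eq_comm, SimpleGraph.edgeSet_eq_empty]
    exact Subsingleton.elim _ _

theorem mult_one_ne_zero_of_isolated_edge [Finite V] {G : SimpleGraph V} {a b : V}
    (hab : G.Adj a b) (ha : ∀ v, G.Adj a v → v = b) (hb : ∀ v, G.Adj b v → v = a) :
    mult 1 G ≠ 0 := by
  classical
  have := Fintype.ofFinite V
  rw [Ne, mult_eq_zero_iff, not_not,
    eval_one_matchingPoly G (E := insert s(a, b) (G.edgeFinset.erase s(a, b))),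
    signedCount_insert (by simp), Finset.filter_true_of_mem, sub_self]
  · intro f hf v hv hvf
    rw [Finset.mem_erase, SimpleGraph.mem_edgeFinset] at hf
    obtain ⟨hne, hf⟩ := hf
    obtain ⟨w, rfl⟩ := Sym2.mem_iff_exists.1 hvf
    rw [SimpleGraph.mem_edgeSet] at hf
    rcases Sym2.mem_iff.1 hv with rfl | rfl
    · exact hne (by rw [ha w hf])
    · exact hne (by rw [hb w hf, Sym2.eq_swap])
  · rw [Finset.insert_erase (by simpa using hab)]
    simp

theorem mult_one_eq_one_of_card_eq_two {G : SimpleGraph V} (hV : Nat.card V = 2) {a b : V}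
    (hab : G.Adj a b) : mult 1 G = 1 := by
  have : Finite V := Nat.finite_of_card_ne_zero (by omega)
  have hother : ∀ u v w : V, u ≠ v → w ≠ u → w = v := by
    intro u v w huv hwu
    by_contra hwv
    have := Fintype.ofFinite V
    rw [Nat.card_eq_fintype_card] at hV
    have := Fintype.two_lt_card_iff.2 ⟨u, v, w, huv, hwu.symm, Ne.symm hwv⟩
    omega
  have h0 : mult 1 G ≠ 0 := mult_one_ne_zero_of_isolated_edge hab
    (fun v hv => hother a b v hab.ne hv.ne') (fun v hv => hother b a v hab.ne' hv.ne')
  have h1 : ¬ 1 < mult 1 G := by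
    rw [mult, one_lt_rootMultiplicity_iff_isRoot (matchingPoly_ne_zero G)]
    rintro ⟨-, h⟩
    rw [matchingPoly, hV] at h
    simp [Finset.sum_range_succ, numMatchings_zero, IsRoot] at h
  omega

theorem isCritical_one_of_card_eq_two {G : SimpleGraph V} (hV : Nat.card V = 2) {a b : V}
    (hab : G.Adj a b) : IsCritical 1 G := by
  have h1 := mult_one_eq_one_of_card_eq_two hV hab
  refine ⟨fun v => ?_, h1⟩
  have : Finite V := Nat.finite_of_card_ne_zero (by omega)
  have hs : Subsingleton ↥({v}ᶜ : Set V) := by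
    rw [← Finite.card_le_one_iff_subsingleton]
    have := Set.ncard_add_ncard_compl ({v} : Set V)
    rw [Set.ncard_singleton] at this
    rw [Nat.card_coe_set_eq]
    omega
  rw [IsEssential, deleteVert, mult_one_eq_zero_of_subsingleton, h1]

/-- The edges `{a, a+1}, …, {a+n-1, a+n}` of a path in `ℕ`. -/
def pathEdges (a n : ℕ) : Finset (Sym2 ℕ) :=
  (Finset.range n).image fun i => s(a + i, a + i + 1)

theorem mem_pathEdges {a n : ℕ} {e : Sym2 ℕ} :
    e ∈ pathEdges a n ↔ ∃ i, a ≤ i ∧ i < a + n ∧ e = s(i, i + 1) := by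
  simp only [pathEdges, Finset.mem_image, Finset.mem_range]
  constructor
  · rintro ⟨i, hi, rfl⟩
    exact ⟨a + i, by omega, by omega, rfl⟩
  · rintro ⟨i, h1, h2, rfl⟩
    refine ⟨i - a, by omega, ?_⟩
    rw [Nat.add_sub_cancel' h1]

theorem signedCount_pathEdges_add_two (a n : ℕ) :
    signedCount (pathEdges a (n + 2)) =
      signedCount (pathEdges a (n + 1)) - signedCount (pathEdges a n) := by
  classical
  have h : pathEdges a (n + 2) = insert s(a + n + 1, a + n + 2) (pathEdges a (n + 1)) := by
    rw [pathEdges, Finset.range_add_one, Finset.image_insert]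
    rfl
  rw [h, signedCount_insert]
  · congr 2
    ext e
    rw [Finset.mem_filter, mem_pathEdges, mem_pathEdges]
    constructor
    · rintro ⟨⟨i, h1, h2, rfl⟩, hd⟩
      refine ⟨i, h1, ?_, rfl⟩
      by_contra h3
      exact hd (a + n + 1) (by simp) (by simp; omega)
    · rintro ⟨i, h1, h2, rfl⟩
      refine ⟨⟨i, h1, by omega, rfl⟩, ?_⟩
      intro v hv hv'
      simp only [Sym2.mem_iff] at hv hv'
      omega
  · rw [mem_pathEdges]
    rintro ⟨i, h1, h2, h3⟩
    simp only [Sym2.eq_iff] at h3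
    omega

theorem signedCount_pathEdges_three_mul (a m : ℕ) :
    signedCount (pathEdges a (3 * m)) = (-1) ^ m ∧
      signedCount (pathEdges a (3 * m + 1)) = 0 := by
  induction m with
  | zero =>
    have h0 : signedCount (pathEdges a 0) = 1 := signedCount_empty
    refine ⟨by simpa using h0, ?_⟩
    have h : pathEdges a 1 = insert s(a, a + 1) ∅ := by
      simp [pathEdges]
    classical
    rw [mul_zero, zero_add, h, signedCount_insert (by simp)]
    simp
  | succ m ih =>
    have h2 := signedCount_pathEdges_add_two a (3 * m)
    have h3 := signedCount_pathEdges_add_two a (3 * m + 1)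
    have h4 := signedCount_pathEdges_add_two a (3 * m + 2)
    rw [mul_add, mul_one]
    refine ⟨?_, ?_⟩
    · rw [h3, h2, ih.1, ih.2]; ring
    · rw [h4, h3, h2, ih.1, ih.2]; ring

theorem cycleGraph_adj_iff {n : ℕ} [NeZero n] (hn : 2 ≤ n) {u v : Fin n} :
    (SimpleGraph.cycleGraph n).Adj u v ↔ v = u + 1 ∨ u = v + 1 := by
  obtain ⟨m, rfl⟩ : ∃ m, n = m + 2 := ⟨n - 2, by omega⟩
  rw [SimpleGraph.cycleGraph_adj, sub_eq_iff_eq_add', sub_eq_iff_eq_add', or_comm]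

theorem mult_one_cycleGraph_three_mul {k : ℕ} (hk : 0 < k) :
    mult 1 (SimpleGraph.cycleGraph (3 * k)) = 0 := by
  classical
  obtain ⟨m, rfl⟩ : ∃ m, k = m + 1 := ⟨k - 1, by omega⟩
  have : NeZero (3 * (m + 1)) := ⟨by omega⟩
  set G := SimpleGraph.cycleGraph (3 * (m + 1)) with hG
  rw [mult_eq_zero_iff, eval_one_matchingPoly G (E := G.edgeFinset) (by simp),
    ← signedCount_map Fin.valEmbedding]
  have hval : ∀ u v : Fin (3 * (m + 1)), G.Adj u v ↔
      (v : ℕ) = u + 1 ∨ (u : ℕ) = v + 1 ∨ (u : ℕ) = 0 ∧ (v : ℕ) = 3 * m + 2 ∨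
        (v : ℕ) = 0 ∧ (u : ℕ) = 3 * m + 2 := by
    intro u v
    rw [hG, SimpleGraph.cycleGraph_adj', Fin.sub_def, Fin.sub_def]
    have := u.2
    have := v.2
    simp only
    rcases lt_or_ge v u with h | h
    · rw [Fin.lt_def] at h
      rw [show 3 * (m + 1) - (v : ℕ) + u = (u - v) + 3 * (m + 1) by omega, Nat.add_mod_right,
        Nat.mod_eq_of_lt (by omega), Nat.mod_eq_of_lt (by omega)]
      omega
    · rw [Fin.le_def] at h
      rw [show 3 * (m + 1) - (u : ℕ) + v = (v - u) + 3 * (m + 1) by omega, Nat.add_mod_right,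
        Nat.mod_eq_of_lt (b := 3 * (m + 1)) (a := v - u) (by omega)]
      rcases h.eq_or_lt with h' | h'
      · rw [h', Nat.sub_add_cancel (by omega), Nat.mod_self]
        omega
      · rw [Nat.mod_eq_of_lt (by omega)]
        omega
  have hE : G.edgeFinset.map Fin.valEmbedding.sym2Map =
      insert s(3 * m + 2, 0) (pathEdges 0 (3 * m + 2)) := by
    ext e
    rw [Finset.mem_map, Finset.mem_insert, mem_pathEdges]
    constructor
    · rintro ⟨f, hf, rfl⟩
      rw [SimpleGraph.mem_edgeFinset] at hf
      induction f with
      | _ u v =>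
        rw [SimpleGraph.mem_edgeSet, hval] at hf
        have := u.2
        have := v.2
        simp only [Function.Embedding.sym2Map_apply, Sym2.map_mk, Fin.valEmbedding_apply]
        rcases hf with h | h | h | h
        · exact Or.inr ⟨u, by omega, by omega, by rw [h]⟩
        · exact Or.inr ⟨v, by omega, by omega, by rw [h, Sym2.eq_swap]⟩
        · exact Or.inl (by rw [h.1, h.2, Sym2.eq_swap])
        · exact Or.inl (by rw [h.1, h.2])
    · rintro (rfl | ⟨i, h1, h2, rfl⟩)
      · refine ⟨s(⟨3 * m + 2, by omega⟩, ⟨0, by omega⟩), ?_, rfl⟩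
        rw [SimpleGraph.mem_edgeFinset, SimpleGraph.mem_edgeSet, hval]
        simp
      · refine ⟨s(⟨i, by omega⟩, ⟨i + 1, by omega⟩), ?_, rfl⟩
        rw [SimpleGraph.mem_edgeFinset, SimpleGraph.mem_edgeSet, hval]
        simp
  have hF : (pathEdges 0 (3 * m + 2)).filter (EdgeDisjoint s(3 * m + 2, 0)) =
      pathEdges 1 (3 * m) := by
    ext e
    rw [Finset.mem_filter, mem_pathEdges, mem_pathEdges]
    constructor
    · rintro ⟨⟨i, h1, h2, rfl⟩, hd⟩
      have hd1 := hd (3 * m + 2) (by simp)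
      have hd2 := hd 0 (by simp)
      simp only [Sym2.mem_iff] at hd1 hd2
      exact ⟨i, by omega, by omega, rfl⟩
    · rintro ⟨i, h1, h2, rfl⟩
      refine ⟨⟨i, by omega, by omega, rfl⟩, ?_⟩
      intro v hv hv'
      simp only [Sym2.mem_iff] at hv hv'
      omega
  rw [hE, signedCount_insert, hF, signedCount_pathEdges_add_two,
    (signedCount_pathEdges_three_mul 0 m).1, (signedCount_pathEdges_three_mul 0 m).2,
    (signedCount_pathEdges_three_mul 1 m).1]
  · have : ((-1 : ℝ) ^ m) ≠ 0 := by simp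
    intro h
    exact this (by linarith)
  · rw [mem_pathEdges]
    rintro ⟨i, h1, h2, h3⟩
    simp only [Sym2.eq_iff] at h3
    omega

theorem mem_of_reachable_of_closed {G : SimpleGraph V} {S : Set V}
    (hS : ∀ u ∈ S, ∀ v, G.Adj u v → v ∈ S) {u v : V} (hu : u ∈ S) (h : G.Reachable u v) :
    v ∈ S := by
  obtain ⟨p⟩ := h
  induction p with
  | nil => exact hu
  | cons hadj _ ih => exact ih (hS _ hu _ hadj)

section Cycle

variable {n : ℕ} [NeZero n] {X : Set (Fin n)}

theorem fin_add_one_ne_self (hn : 3 ≤ n) (x : Fin n) : x + 1 ≠ x := by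
  simp only [ne_eq, add_eq_left, Fin.ext_iff, Fin.val_one', Fin.val_zero]
  rw [Nat.mod_eq_of_lt (by omega)]
  omega

theorem fin_add_one_add_one_ne_self (hn : 3 ≤ n) (x : Fin n) : x + 1 + 1 ≠ x := by
  simp only [add_assoc, ne_eq, add_eq_left, Fin.ext_iff, Fin.val_add, Fin.val_one', Fin.val_zero]
  rw [Nat.mod_eq_of_lt (by omega : 1 < n), Nat.mod_eq_of_lt (by omega)]
  omega

theorem deleteSet_cycleGraph_adj_iff (hn : 3 ≤ n) {u v : ↥Xᶜ} :
    (deleteSet (SimpleGraph.cycleGraph n) X).Adj u v ↔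
      (v : Fin n) = u + 1 ∨ (u : Fin n) = v + 1 := by
  rw [deleteSet, SimpleGraph.comap_adj, cycleGraph_adj_iff (by omega)]
  rfl

theorem fin_val_nsmul_one (d : Fin n) : d.val • (1 : Fin n) = d := by
  have h : ∀ j : ℕ, ((j • (1 : Fin n) : Fin n) : ℕ) = j % n := by
    intro j
    induction j with
    | zero => simp
    | succ j ih => rw [succ_nsmul, Fin.val_add, ih, Fin.val_one', ← Nat.add_mod]
  rw [Fin.ext_iff, h, Nat.mod_eq_of_lt d.2]

theorem exists_component_start (hn : 3 ≤ n) (hX : X.Nonempty)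
    (c : (deleteSet (SimpleGraph.cycleGraph n) X).ConnectedComponent) :
    ∃ x ∈ X, ∃ h : x + 1 ∉ X,
      (deleteSet (SimpleGraph.cycleGraph n) X).connectedComponentMk ⟨x + 1, h⟩ = c := by
  by_contra! hc
  induction c using SimpleGraph.ConnectedComponent.ind with
  | h v =>
  have key : ∀ j : ℕ, ∃ h : (v : Fin n) - j • (1 : Fin n) ∉ X,
      (deleteSet (SimpleGraph.cycleGraph n) X).connectedComponentMk ⟨v - j • (1 : Fin n), h⟩ =
        (deleteSet (SimpleGraph.cycleGraph n) X).connectedComponentMk v := by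
    intro j
    induction j with
    | zero =>
      have h0 : (v : Fin n) - 0 • (1 : Fin n) = v := by simp
      exact ⟨fun h => v.2 (h0 ▸ h), congrArg _ (Subtype.ext h0)⟩
    | succ j ih =>
      obtain ⟨h, hj⟩ := ih
      have hstep : (v : Fin n) - (j + 1) • (1 : Fin n) + 1 = v - j • (1 : Fin n) := by
        rw [succ_nsmul]
        abel
      have hmem : (v : Fin n) - (j + 1) • (1 : Fin n) ∉ X := by
        intro hx
        refine hc _ hx (hstep ▸ h) ?_
        rw [← hj]
        exact congrArg _ (Subtype.ext hstep)
      refine ⟨hmem, ?_⟩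
      rw [← hj, SimpleGraph.ConnectedComponent.eq]
      exact ((deleteSet_cycleGraph_adj_iff hn).2 (Or.inl hstep.symm)).reachable
  obtain ⟨x, hx⟩ := hX
  obtain ⟨h, -⟩ := key ((v : Fin n) - x).val
  rw [fin_val_nsmul_one, sub_sub_cancel] at h
  exact h hx

/-- The vertices of `X` that are followed on the cycle by exactly two vertices outside `X`. -/
def gapTwoStarts (X : Set (Fin n)) : Set (Fin n) :=
  {x | x ∈ X ∧ x + 1 ∉ X ∧ x + 1 + 1 ∉ X ∧ x + 1 + 1 + 1 ∈ X}

theorem reachable_of_mem_gapTwoStarts (hn : 3 ≤ n) {x : Fin n} (hx : x ∈ gapTwoStarts X)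
    {v : ↥Xᶜ} (hv : (deleteSet (SimpleGraph.cycleGraph n) X).Reachable ⟨x + 1, hx.2.1⟩ v) :
    (v : Fin n) = x + 1 ∨ (v : Fin n) = x + 1 + 1 := by
  refine mem_of_reachable_of_closed
    (S := {w : ↥Xᶜ | (w : Fin n) = x + 1 ∨ (w : Fin n) = x + 1 + 1}) ?_ (Or.inl rfl) hv
  rintro ⟨u, hu⟩ huS ⟨w, hw⟩ huw
  simp only [deleteSet_cycleGraph_adj_iff hn, Set.mem_ofPred_eq] at huS huw ⊢
  obtain ⟨h0, h1, h2, h3⟩ := hx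
  rcases huS with rfl | rfl <;> rcases huw with rfl | huw
  · exact Or.inr rfl
  · exact absurd (add_right_cancel huw ▸ h0) hw
  · exact absurd h3 hw
  · exact Or.inl (add_right_cancel huw).symm

theorem isCritical_component_of_mem_gapTwoStarts (hn : 3 ≤ n) {x : Fin n}
    (hx : x ∈ gapTwoStarts X) :
    IsCritical 1 ((deleteSet (SimpleGraph.cycleGraph n) X).induce
      ((deleteSet (SimpleGraph.cycleGraph n) X).connectedComponentMk ⟨x + 1, hx.2.1⟩).supp) := by
  set H := deleteSet (SimpleGraph.cycleGraph n) X
  have hadj : H.Adj ⟨x + 1, hx.2.1⟩ ⟨x + 1 + 1, hx.2.2.1⟩ :=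
    (deleteSet_cycleGraph_adj_iff hn).2 (Or.inl rfl)
  have hsupp : (H.connectedComponentMk ⟨x + 1, hx.2.1⟩).supp =
      {⟨x + 1, hx.2.1⟩, ⟨x + 1 + 1, hx.2.2.1⟩} := by
    ext v
    rw [SimpleGraph.ConnectedComponent.mem_supp_iff, SimpleGraph.ConnectedComponent.eq]
    simp only [Set.mem_insert_iff, Set.mem_singleton_iff]
    constructor
    · intro h
      simpa only [Subtype.ext_iff] using reachable_of_mem_gapTwoStarts hn hx h.symm
    · rintro (rfl | rfl)
      · rfl
      · exact hadj.symm.reachable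
  rw [hsupp]
  let S : Set ↥Xᶜ := {⟨x + 1, hx.2.1⟩, ⟨x + 1 + 1, hx.2.2.1⟩}
  refine isCritical_one_of_card_eq_two (a := (⟨⟨x + 1, hx.2.1⟩, Or.inl rfl⟩ : S))
    (b := (⟨⟨x + 1 + 1, hx.2.2.1⟩, Or.inr rfl⟩ : S)) ?_ hadj
  rw [Nat.card_coe_set_eq, Set.ncard_pair hadj.ne]

theorem mem_gapTwoStarts_of_isCritical (hn : 3 ≤ n) {x : Fin n} (hx : x ∈ X) (hx1 : x + 1 ∉ X)
    (hcrit : IsCritical 1 ((deleteSet (SimpleGraph.cycleGraph n) X).induce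
      ((deleteSet (SimpleGraph.cycleGraph n) X).connectedComponentMk ⟨x + 1, hx1⟩).supp)) :
    x ∈ gapTwoStarts X := by
  set H := deleteSet (SimpleGraph.cycleGraph n) X
  set c := H.connectedComponentMk ⟨x + 1, hx1⟩ with hc
  have hx2 : x + 1 + 1 ∉ X := by
    intro hx2
    have hsub : Subsingleton c.supp := by
      have hall : ∀ v ∈ c.supp, v = ⟨x + 1, hx1⟩ := by
        intro v hv
        rw [SimpleGraph.ConnectedComponent.mem_supp_iff, hc,
          SimpleGraph.ConnectedComponent.eq] at hv
        refine mem_of_reachable_of_closed (S := {(⟨x + 1, hx1⟩ : ↥Xᶜ)}) ?_ rfl hv.symm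
        rintro _ rfl ⟨w, hw⟩ hadj
        rw [deleteSet_cycleGraph_adj_iff hn] at hadj
        rcases hadj with rfl | hadj
        · exact absurd hx2 hw
        · obtain rfl : x = w := add_right_cancel hadj
          exact absurd hx hw
      exact ⟨fun a b => Subtype.ext ((hall a a.2).trans (hall b b.2).symm)⟩
    have := hcrit.2
    rw [mult_one_eq_zero_of_subsingleton] at this
    omega
  refine ⟨hx, hx1, hx2, ?_⟩
  by_contra hx3
  have hadj1 : H.Adj ⟨x + 1, hx1⟩ ⟨x + 1 + 1, hx2⟩ :=
    (deleteSet_cycleGraph_adj_iff hn).2 (Or.inl rfl)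
  have hadj2 : H.Adj ⟨x + 1 + 1, hx2⟩ ⟨x + 1 + 1 + 1, hx3⟩ :=
    (deleteSet_cycleGraph_adj_iff hn).2 (Or.inl rfl)
  have hm1 : ⟨x + 1, hx1⟩ ∈ c.supp := rfl
  have hm2 : ⟨x + 1 + 1, hx2⟩ ∈ c.supp :=
    SimpleGraph.ConnectedComponent.eq.2 hadj1.symm.reachable
  have hm3 : ⟨x + 1 + 1 + 1, hx3⟩ ∈ c.supp :=
    SimpleGraph.ConnectedComponent.eq.2 (hadj2.symm.reachable.trans hadj1.symm.reachable)
  have hess := hcrit.1 ⟨_, hm3⟩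
  rw [IsEssential, hcrit.2, Nat.succ_inj] at hess
  have hne1 : (⟨⟨x + 1, hx1⟩, hm1⟩ : c.supp) ≠ ⟨⟨x + 1 + 1 + 1, hx3⟩, hm3⟩ := by
    intro h
    rw [Subtype.mk.injEq, Subtype.mk.injEq] at h
    exact fin_add_one_add_one_ne_self hn _ h.symm
  have hne2 : (⟨⟨x + 1 + 1, hx2⟩, hm2⟩ : c.supp) ≠ ⟨⟨x + 1 + 1 + 1, hx3⟩, hm3⟩ := by
    intro h
    rw [Subtype.mk.injEq, Subtype.mk.injEq] at h
    exact fin_add_one_ne_self hn _ h.symm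
  refine mult_one_ne_zero_of_isolated_edge (a := ⟨_, hne1⟩) (b := ⟨_, hne2⟩) ?_ ?_ ?_ hess
  · exact hadj1
  · rintro ⟨⟨⟨w, hw⟩, hwc⟩, hw3⟩ hadj
    replace hadj : H.Adj ⟨x + 1, hx1⟩ ⟨w, hw⟩ := hadj
    rw [deleteSet_cycleGraph_adj_iff hn] at hadj
    rcases hadj with rfl | hadj
    · rfl
    · obtain rfl : x = w := add_right_cancel hadj
      exact absurd hx hw
  · rintro ⟨⟨⟨w, hw⟩, hwc⟩, hw3⟩ hadj
    replace hadj : H.Adj ⟨x + 1 + 1, hx2⟩ ⟨w, hw⟩ := hadj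
    rw [deleteSet_cycleGraph_adj_iff hn] at hadj
    rcases hadj with rfl | hadj
    · exact absurd rfl hw3
    · obtain rfl := add_right_cancel hadj
      rfl

theorem numCritComponents_deleteSet_cycleGraph (hn : 3 ≤ n) (hX : X.Nonempty) :
    numCritComponents 1 (deleteSet (SimpleGraph.cycleGraph n) X) = (gapTwoStarts X).ncard := by
  rw [numCritComponents, ← Nat.card_coe_set_eq, eq_comm]
  refine Nat.card_congr (Equiv.ofBijective
    (fun x => ⟨_, isCritical_component_of_mem_gapTwoStarts hn x.2⟩) ⟨?_, ?_⟩)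
  · rintro ⟨x, hx⟩ ⟨y, hy⟩ hxy
    rw [Subtype.mk.injEq, SimpleGraph.ConnectedComponent.eq] at hxy
    rcases reachable_of_mem_gapTwoStarts hn hx hxy with h | h
    · exact Subtype.ext (add_right_cancel h).symm
    · exact absurd (add_right_cancel h ▸ hy.1) hx.2.1
  · rintro ⟨c, hc⟩
    obtain ⟨x, hx, hx1, rfl⟩ := exists_component_start hn hX c
    exact ⟨⟨x, mem_gapTwoStarts_of_isCritical hn hx hx1 hc⟩, rfl⟩

end Cycle

theorem isBarrier_cycleGraph_three_mul_iff {k : ℕ} [NeZero (3 * k)] {X : Set (Fin (3 * k))}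
    (hX : X.Nonempty) :
    IsBarrier 1 (SimpleGraph.cycleGraph (3 * k)) X ↔
      ∀ x ∈ X, x + 1 ∉ X ∧ x + 1 + 1 ∉ X ∧ x + 1 + 1 + 1 ∈ X := by
  have hk : 0 < k := by
    have := NeZero.ne (3 * k)
    omega
  have hsub : gapTwoStarts X ⊆ X := fun x hx => hx.1
  rw [IsBarrier, mult_one_cycleGraph_three_mul hk, zero_add,
    numCritComponents_deleteSet_cycleGraph (by omega) hX]
  constructor
  · intro h x hx
    rw [← Set.eq_of_subset_of_ncard_le hsub h.ge] at hx
    exact hx.2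
  · intro h
    rw [hsub.antisymm fun x hx => ⟨hx, h x hx⟩]

theorem val_add_one_mod_three {k : ℕ} [NeZero (3 * k)] (x : Fin (3 * k)) :
    ((x + 1 : Fin (3 * k)) : ℕ) % 3 = ((x : ℕ) + 1) % 3 := by
  rw [Fin.val_add, Fin.val_one', Nat.add_mod_mod, Nat.mod_mul_right_mod]

theorem eq_residueClass_of_three_periodic {k : ℕ} [NeZero (3 * k)] {X : Set (Fin (3 * k))}
    (h : ∀ x ∈ X, x + 1 ∉ X ∧ x + 1 + 1 ∉ X ∧ x + 1 + 1 + 1 ∈ X) {x : Fin (3 * k)} (hx : x ∈ X) :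
    X = {i : Fin (3 * k) | (i : ℕ) % 3 = (x : ℕ) % 3} := by
  have key : ∀ j : ℕ, x + (3 * j) • (1 : Fin (3 * k)) ∈ X ∧
      ((x + (3 * j) • (1 : Fin (3 * k)) : Fin (3 * k)) : ℕ) % 3 = (x : ℕ) % 3 := by
    intro j
    induction j with
    | zero => simpa using hx
    | succ j ih =>
      have hstep : x + (3 * (j + 1)) • (1 : Fin (3 * k)) =
          x + (3 * j) • (1 : Fin (3 * k)) + 1 + 1 + 1 := by
        rw [show 3 * (j + 1) = 3 * j + 1 + 1 + 1 by ring, succ_nsmul, succ_nsmul, succ_nsmul]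
        simp only [add_assoc]
      rw [hstep]
      refine ⟨(h _ ih.1).2.2, ?_⟩
      have h1 := val_add_one_mod_three (x + (3 * j) • (1 : Fin (3 * k)))
      have h2 := val_add_one_mod_three (x + (3 * j) • (1 : Fin (3 * k)) + 1)
      have h3 := val_add_one_mod_three (x + (3 * j) • (1 : Fin (3 * k)) + 1 + 1)
      omega
  ext y
  rw [Set.mem_ofPred_eq]
  have hy : y = x + (y - x).val • (1 : Fin (3 * k)) := by
    rw [fin_val_nsmul_one, add_sub_cancel]
  set d := (y - x).val
  obtain ⟨hz, hzmod⟩ := key (d / 3)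
  have hd := Nat.div_add_mod d 3
  set z := x + (3 * (d / 3)) • (1 : Fin (3 * k)) with hzdef
  have hyz : y = z + (d % 3) • (1 : Fin (3 * k)) := by
    rw [hy, hzdef, add_assoc, ← add_nsmul, hd]
  have h1 := val_add_one_mod_three z
  have h2 := val_add_one_mod_three (z + 1)
  have hlt := Nat.mod_lt d (by norm_num : 3 > 0)
  generalize d % 3 = r at hyz hlt
  interval_cases r
  · rw [zero_nsmul, add_zero] at hyz
    rw [hyz]
    exact iff_of_true hz hzmod
  · rw [one_nsmul] at hyz
    rw [hyz]
    exact iff_of_false (h z hz).1 (by omega)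
  · rw [two_nsmul, ← add_assoc] at hyz
    rw [hyz]
    exact iff_of_false (h z hz).2.1 (by omega)

theorem residueClass_nonempty {k : ℕ} (hk : 0 < k) {r : ℕ} (hr : r < 3) :
    {i : Fin (3 * k) | (i : ℕ) % 3 = r}.Nonempty :=
  ⟨⟨r, by omega⟩, Nat.mod_eq_of_lt hr⟩

theorem residueClass_ne {k : ℕ} (hk : 0 < k) {r s : ℕ} (hr : r < 3) (hrs : r ≠ s) :
    {i : Fin (3 * k) | (i : ℕ) % 3 = r} ≠ {i : Fin (3 * k) | (i : ℕ) % 3 = s} := by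
  obtain ⟨i, hi⟩ := residueClass_nonempty hk hr
  intro h
  have hi' := h ▸ hi
  rw [Set.mem_ofPred_eq] at hi hi'
  exact hrs (hi.symm.trans hi')

theorem isBarrier_residueClass {k : ℕ} (hk : 0 < k) {r : ℕ} (hr : r < 3) :
    IsBarrier 1 (SimpleGraph.cycleGraph (3 * k)) {i : Fin (3 * k) | (i : ℕ) % 3 = r} := by
  have : NeZero (3 * k) := ⟨by omega⟩
  rw [isBarrier_cycleGraph_three_mul_iff (residueClass_nonempty hk hr)]
  intro x hx
  simp only [Set.mem_ofPred_eq] at hx ⊢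
  have h1 := val_add_one_mod_three x
  have h2 := val_add_one_mod_three (x + 1)
  have h3 := val_add_one_mod_three (x + 1 + 1)
  omega

/-- C_{3k} has exactly three nonempty 1-barrier sets: the three residue classes mod 3. -/
theorem stmt_13 (k : ℕ) (hk : 0 < k) :
    {X : Set (Fin (3 * k)) | X.Nonempty ∧ IsBarrier 1 (SimpleGraph.cycleGraph (3 * k)) X} =
        {{i : Fin (3 * k) | (i : ℕ) % 3 = 0}, {i : Fin (3 * k) | (i : ℕ) % 3 = 1},
          {i : Fin (3 * k) | (i : ℕ) % 3 = 2}} ∧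
      ({i : Fin (3 * k) | (i : ℕ) % 3 = 0} ≠ {i : Fin (3 * k) | (i : ℕ) % 3 = 1} ∧
        {i : Fin (3 * k) | (i : ℕ) % 3 = 0} ≠ {i : Fin (3 * k) | (i : ℕ) % 3 = 2} ∧
        {i : Fin (3 * k) | (i : ℕ) % 3 = 1} ≠ {i : Fin (3 * k) | (i : ℕ) % 3 = 2}) := by
  refine ⟨?_, residueClass_ne hk (by norm_num) (by norm_num),
    residueClass_ne hk (by norm_num) (by norm_num), residueClass_ne hk (by norm_num) (by norm_num)⟩
  have : NeZero (3 * k) := ⟨by omega⟩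
  ext X
  simp only [Set.mem_ofPred_eq, Set.mem_insert_iff, Set.mem_singleton_iff]
  constructor
  · rintro ⟨⟨x, hx⟩, hbar⟩
    have hX := eq_residueClass_of_three_periodic
      ((isBarrier_cycleGraph_three_mul_iff ⟨x, hx⟩).1 hbar) hx
    have hlt := Nat.mod_lt (x : ℕ) (by norm_num : 3 > 0)
    generalize (x : ℕ) % 3 = r at hX hlt
    interval_cases r
    · exact Or.inl hX
    · exact Or.inr (Or.inl hX)
    · exact Or.inr (Or.inr hX)
  · rintro (rfl | rfl | rfl)
    · exact ⟨residueClass_nonempty hk (by norm_num), isBarrier_residueClass hk (by norm_num)⟩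
    · exact ⟨residueClass_nonempty hk (by norm_num), isBarrier_residueClass hk (by norm_num)⟩
    · exact ⟨residueClass_nonempty hk (by norm_num), isBarrier_residueClass hk (by norm_num)⟩

end MatchPoly
end
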